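/- Let f, g and h be entire functions given by everywhere absolutely convergent vector valued Dirichlet series, and let p ≥ 0, q ≥ 0, m ≥ 0 be integers. Assume 0 < λ_h^{(m,q)}(f) = ρ_h^{(m,q)}(f) < +∞, 0 < λ_h^{(m,p)}(g) ≤ ρ_h^{(m,p)}(g) < +∞, and that the indicators Δ_h^{(m,q)}(f), Δ̄_h^{(m,q)}(f), Δ_h^{(m,p)}(g), Δ̄_h^{(m,p)}(g), τ_h^{(m,q)}(f), τ̄_h^{(m,q)}(f), τ_h^{(m,p)}(g), τ̄_h^{(m,p)}(g) are all positive and finite. Then: (Δ̄_h^{(m,q)}(f)/Δ_h^{(m,p)}(g))^{1/ρ_h^{(m,p)}(g)} ≤ τ_g^{(p,q)}(f) ≤ min{ (Δ̄_h^{(m,q)}(f)/Δ̄_h^{(m,p)}(g))^{1/ρ_h^{(m,p)}(g)}, (Δ_h^{(m,q)}(f)/Δ_h^{(m,p)}(g))^{1/ρ_h^{(m,p)}(g)} } ≤ max{ (Δ̄_h^{(m,q)}(f)/Δ̄_h^{(m,p)}(g))^{1/ρ_h^{(m,p)}(g)}, (Δ_h^{(m,q)}(f)/Δ_h^{(m,p)}(g))^{1/ρ_h^{(m,p)}(g)}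 } ≤ τ̄_g^{(p,q)}(f) ≤ (Δ_h^{(m,q)}(f)/Δ̄_h^{(m,p)}(g))^{1/ρ_h^{(m,p)}(g)}; and (τ_h^{(m,q)}(f)/τ̄_h^{(m,p)}(g))^{1/λ_h^{(m,p)}(g)} ≤ Δ̄_g^{(p,q)}(f) ≤ min{ (τ_h^{(m,q)}(f)/τ_h^{(m,p)}(g))^{1/λ_h^{(m,p)}(g)}, (τ̄_h^{(m,q)}(f)/τ̄_h^{(m,p)}(g))^{1/λ_h^{(m,p)}(g)} } ≤ max{ (τ_h^{(m,q)}(f)/τ_h^{(m,p)}(g))^{1/λ_h^{(m,p)}(g)}, (τ̄_h^{(m,q)}(f)/τ̄_h^{(m,p)}(g))^{1/λ_h^{(m,p)}(g)} } ≤ Δ_g^{(p,q)}(f) ≤ (τ̄_h^{(m,q)}(f)/τ_h^{(m,p)}(g))^{1/λ_h^{(m,p)}(g)}. -/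

import Mathlib

open Filter Topology

noncomputable section

/-- An entire function given by an everywhere absolutely convergent
vector valued Dirichlet series, with coefficients in a Banach space `E`. -/
structure VVDS (E : Type*) [NormedAddCommGroup E] [NormedSpace ℂ E] [CompleteSpace E] where
  a : ℕ → E
  lam : ℕ → ℝ
  lam_pos : ∀ n, 0 < lam n
  lam_strictMono : StrictMono lam
  lam_tendsto : Tendsto lam atTop atTop
  log_index_bound : ∃ D : ℝ, ∀ᶠ n : ℕ in atTop, Real.log (n : ℝ) / lam n ≤ D
  coeff_decay : Tendsto (fun n => Real.log ‖a n‖ / lam n) atTop atBot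
  abs_conv : ∀ s : ℂ, Summable (fun n => Real.exp (s.re * lam n) * ‖a n‖)

variable {E F G : Type*} [NormedAddCommGroup E] [NormedSpace ℂ E] [CompleteSpace E]
  [NormedAddCommGroup F] [NormedSpace ℂ F] [CompleteSpace F]
  [NormedAddCommGroup G] [NormedSpace ℂ G] [CompleteSpace G]

/-- The entire function defined by the vector valued Dirichlet series. -/
def VVDS.toFun (f : VVDS E) (s : ℂ) : E := ∑' n, Complex.exp (s * (f.lam n : ℂ)) • f.a n

/-- The maximum modulus function `M_f(σ) = sup_t ‖f(σ+it)‖`. -/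
def VVDS.M (f : VVDS E) (σ : ℝ) : ℝ := ⨆ t : ℝ, ‖f.toFun ((σ : ℂ) + (t : ℂ) * Complex.I)‖

/-- The inverse function of the maximum modulus function. -/
def VVDS.Minv (f : VVDS E) (y : ℝ) : ℝ := sInf {σ : ℝ | y ≤ f.M σ}

/-- The (p,q)-th relative Ritt order of `f` with respect to `g`. -/
def relRittOrder (p q : ℕ) (f : VVDS E) (g : VVDS F) : EReal :=
  limsup (fun σ : ℝ =>
    ((Real.log^[p] (g.Minv (f.M σ)) / Real.log^[q] σ : ℝ) : EReal)) atTop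

/-- The (p,q)-th relative Ritt lower order of `f` with respect to `g`. -/
def relRittLowerOrder (p q : ℕ) (f : VVDS E) (g : VVDS F) : EReal :=
  liminf (fun σ : ℝ =>
    ((Real.log^[p] (g.Minv (f.M σ)) / Real.log^[q] σ : ℝ) : EReal)) atTop

/-- The (p,q)-th relative Ritt type of `f` with respect to `g`. -/
def relRittType (p q : ℕ) (f : VVDS E) (g : VVDS F) : EReal :=
  limsup (fun σ : ℝ =>
    ((Real.log^[p-1] (g.Minv (f.M σ)) /
      (Real.log^[q-1] σ) ^ (relRittOrder p q f g).toReal : ℝ) : EReal)) atTop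

/-- The (p,q)-th relative Ritt lower type of `f` with respect to `g`. -/
def relRittLowerType (p q : ℕ) (f : VVDS E) (g : VVDS F) : EReal :=
  liminf (fun σ : ℝ =>
    ((Real.log^[p-1] (g.Minv (f.M σ)) /
      (Real.log^[q-1] σ) ^ (relRittOrder p q f g).toReal : ℝ) : EReal)) atTop

/-- The (p,q)-th relative Ritt weak type of `f` with respect to `g`. -/
def relRittWeakType (p q : ℕ) (f : VVDS E) (g : VVDS F) : EReal :=
  liminf (fun σ : ℝ =>
    ((Real.log^[p-1] (g.Minv (f.M σ)) /
      (Real.log^[q-1] σ) ^ (relRittLowerOrder p q f g).toReal : ℝ) : EReal)) atTop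

/-- The growth indicator `τ̄_g^{(p,q)}(f)`. -/
def relRittUpperWeakType (p q : ℕ) (f : VVDS E) (g : VVDS F) : EReal :=
  limsup (fun σ : ℝ =>
    ((Real.log^[p-1] (g.Minv (f.M σ)) /
      (Real.log^[q-1] σ) ^ (relRittLowerOrder p q f g).toReal : ℝ) : EReal)) atTop

lemma VVDS.norm_term (f : VVDS E) (s : ℂ) (n : ℕ) :
    ‖Complex.exp (s * (f.lam n : ℂ)) • f.a n‖ = Real.exp (s.re * f.lam n) * ‖f.a n‖ := by
  rw [norm_smul, Complex.norm_exp]; simp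

lemma VVDS.summable_real (f : VVDS E) (σ : ℝ) :
    Summable (fun n => Real.exp (σ * f.lam n) * ‖f.a n‖) := by
  simpa using f.abs_conv (σ : ℂ)

lemma VVDS.summable_term (f : VVDS E) (s : ℂ) :
    Summable (fun n => Complex.exp (s * (f.lam n : ℂ)) • f.a n) := by
  apply Summable.of_norm
  simp only [f.norm_term]
  exact f.abs_conv s

lemma VVDS.norm_le (f : VVDS E) (s : ℂ) (σ : ℝ) (h : s.re ≤ σ) :
    ‖f.toFun s‖ ≤ ∑' n, Real.exp (σ * f.lam n) * ‖f.a n‖ := by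
  have h1 : ‖f.toFun s‖ ≤ ∑' n, ‖Complex.exp (s * (f.lam n : ℂ)) • f.a n‖ := by
    apply norm_tsum_le_tsum_norm
    simp only [f.norm_term]; exact f.abs_conv s
  refine h1.trans ?_
  simp only [f.norm_term]
  apply (f.abs_conv s).tsum_le_tsum _ (f.summable_real σ)
  intro n
  have := f.lam_pos n
  gcongr

lemma VVDS.differentiable (f : VVDS E) : Differentiable ℂ f.toFun := by
  intro s
  have hU : IsOpen {w : ℂ | w.re < s.re + 1} := isOpen_lt Complex.continuous_re continuous_const
  have := Complex.differentiableOn_tsum_of_summable_norm (U := {w : ℂ | w.re < s.re + 1})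
    (F := fun n w => Complex.exp (w * (f.lam n : ℂ)) • f.a n)
    (f.summable_real (s.re + 1)) (fun n => by fun_prop) hU (by
      intro n w hw
      rw [f.norm_term]
      have := f.lam_pos n
      have hw' : w.re ≤ s.re + 1 := le_of_lt hw
      gcongr)
  exact this.differentiableAt (hU.mem_nhds (by simp))

lemma VVDS.bdd (f : VVDS E) (σ : ℝ) :
    BddAbove (Set.range fun t : ℝ => ‖f.toFun ((σ : ℂ) + (t : ℂ) * Complex.I)‖) := by
  refine ⟨∑' n, Real.exp (σ * f.lam n) * ‖f.a n‖, ?_⟩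
  rintro _ ⟨t, rfl⟩
  exact f.norm_le _ _ (by simp)

lemma VVDS.norm_le_M (f : VVDS E) (s : ℂ) : ‖f.toFun s‖ ≤ f.M s.re := by
  have := le_ciSup (f.bdd s.re) s.im
  simpa [VVDS.M] using this

lemma VVDS.M_nonneg (f : VVDS E) (σ : ℝ) : 0 ≤ f.M σ :=
  (norm_nonneg _).trans (by simpa using f.norm_le_M (σ : ℂ))

lemma VVDS.three_lines (f : VVDS E) {l x u : ℝ} (h1 : l < x) (h2 : x < u) :
    f.M x ≤ f.M l ^ (1 - (x - l) / (u - l)) * f.M u ^ ((x - l) / (u - l)) := by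
  apply ciSup_le
  intro t
  have := Complex.HadamardThreeLines.norm_le_interp_of_mem_verticalClosedStrip' (f := f.toFun)
    (z := (x : ℂ) + (t : ℂ) * Complex.I) (a := f.M l) (b := f.M u) (h1.trans h2)
    (by simp [Complex.HadamardThreeLines.verticalClosedStrip, h1.le, h2.le])
    f.differentiable.diffContOnCl
    ⟨∑' n, Real.exp (u * f.lam n) * ‖f.a n‖, by
      rintro _ ⟨w, hw, rfl⟩
      exact f.norm_le _ _ hw.2⟩
    (by rintro z rfl; exact f.norm_le_M z)
    (by rintro z rfl; exact f.norm_le_M z)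
  simpa using this

lemma VVDS.coeff_zero (f : VVDS E) (hf : ∀ s, f.toFun s = 0) (n : ℕ) : f.a n = 0 := by
  induction n using Nat.strong_induction_on with
  | _ n ih =>
  have key : ∀ σ : ℝ, σ ≤ 0 → ‖f.a n‖ ≤ Real.exp (σ * (f.lam (n+1) - f.lam n)) * ∑' k, ‖f.a k‖ := by
    intro σ hσ
    have hs : Summable (fun k => ‖f.a k‖) := by simpa using f.summable_real 0
    have h1 := hf σ
    unfold VVDS.toFun at h1
    rw [(f.summable_term σ).tsum_eq_add_tsum_ite n] at h1
    have h2 : ‖Complex.exp ((σ : ℂ) * (f.lam n : ℂ)) • f.a n‖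
        ≤ ∑' k, Real.exp (σ * f.lam (n+1)) * ‖f.a k‖ := by
      rw [eq_neg_of_add_eq_zero_left h1, norm_neg]
      apply tsum_of_norm_bounded (hs.mul_left _).hasSum
      intro k
      split_ifs with hk
      · simp; positivity
      · rw [f.norm_term]
        rcases lt_or_gt_of_ne hk with hk | hk
        · simp [ih k hk]
        · have h3 : f.lam (n+1) ≤ f.lam k := f.lam_strictMono.monotone hk
          have : σ * f.lam k ≤ σ * f.lam (n+1) := mul_le_mul_of_nonpos_left h3 hσ
          simp only [Complex.ofReal_re]
          gcongr
    rw [f.norm_term, tsum_mul_left, Complex.ofReal_re] at h2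
    have h3 : Real.exp (σ * (f.lam (n+1) - f.lam n)) = Real.exp (σ * f.lam (n+1)) / Real.exp (σ * f.lam n) := by
      rw [← Real.exp_sub]; ring_nf
    rw [h3, div_mul_eq_mul_div, le_div_iff₀ (Real.exp_pos _)]
    linarith
  have hd : 0 < f.lam (n+1) - f.lam n := sub_pos.2 (f.lam_strictMono (Nat.lt_succ_self n))
  have ht : Tendsto (fun σ : ℝ => Real.exp (σ * (f.lam (n+1) - f.lam n)) * ∑' k, ‖f.a k‖) atBot (𝓝 (0 * ∑' k, ‖f.a k‖)) := by
    apply Tendsto.mul_const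
    exact Real.tendsto_exp_atBot.comp (tendsto_id.atBot_mul_const hd)
  rw [zero_mul] at ht
  have := ge_of_tendsto ht ((eventually_le_atBot 0).mono key)
  exact norm_le_zero_iff.1 this

lemma VVDS.M_pos (f : VVDS E) (σ : ℝ) : 0 < f.M σ := by
  by_contra hc
  have h0 : f.M σ = 0 := le_antisymm (not_lt.1 hc) (f.M_nonneg σ)
  have hall : ∀ x, f.M x = 0 := by
    intro x
    rcases lt_trichotomy x σ with hx | rfl | hx
    · have h := f.three_lines (l := x - 1) (x := x) (u := σ) (by linarith) hx
      rw [h0, Real.zero_rpow, mul_zero] at h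
      · exact le_antisymm h (f.M_nonneg x)
      · have : 0 < (x - (x-1)) / (σ - (x-1)) := div_pos (by linarith) (by linarith)
        exact this.ne'
    · exact h0
    · have h := f.three_lines (l := σ) (x := x) (u := x + 1) hx (by linarith)
      rw [h0, Real.zero_rpow, zero_mul] at h
      · exact le_antisymm h (f.M_nonneg x)
      · have : (x - σ) / (x + 1 - σ) < 1 := by rw [div_lt_one] <;> linarith
        linarith
  have hz : ∀ n, f.a n = 0 := f.coeff_zero fun s => by
    have := f.norm_le_M s
    rw [hall] at this
    exact norm_le_zero_iff.1 this
  have hd := f.coeff_decay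
  simp only [hz, norm_zero, Real.log_zero, zero_div] at hd
  obtain ⟨n, hn⟩ := (hd.eventually (eventually_lt_atBot 0)).exists
  exact lt_irrefl _ hn

lemma VVDS.log_convex (f : VVDS E) : ConvexOn ℝ Set.univ (fun σ => Real.log (f.M σ)) := by
  apply convexOn_of_slope_mono_adjacent convex_univ
  intro x y z _ _ hxy hyz
  have h := f.three_lines hxy hyz
  have h2 := Real.log_le_log (f.M_pos y) h
  rw [Real.log_mul (Real.rpow_pos_of_pos (f.M_pos _) _).ne' (Real.rpow_pos_of_pos (f.M_pos _) _).ne',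
    Real.log_rpow (f.M_pos _), Real.log_rpow (f.M_pos _)] at h2
  have hxz : 0 < z - x := by linarith
  rw [div_le_div_iff₀ (by linarith) (by linarith)]
  have e : (z - x) * ((1 - (y - x) / (z - x)) * Real.log (f.M x) + (y - x) / (z - x) * Real.log (f.M z))
      = (z - y) * Real.log (f.M x) + (y - x) * Real.log (f.M z) := by
    field_simp; ring
  have := mul_le_mul_of_nonneg_left h2 hxz.le
  rw [e] at this
  linarith

lemma VVDS.log_tendsto_bot (f : VVDS E) : Tendsto (fun σ => Real.log (f.M σ)) atBot atBot := by
  have hM : Tendsto f.M atBot (𝓝 0) := by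
    have ht : Tendsto (fun σ : ℝ => Real.exp (σ * f.lam 0) * ∑' k, ‖f.a k‖) atBot
        (𝓝 (0 * ∑' k, ‖f.a k‖)) := by
      apply Tendsto.mul_const
      exact Real.tendsto_exp_atBot.comp (tendsto_id.atBot_mul_const (f.lam_pos 0))
    rw [zero_mul] at ht
    apply tendsto_of_tendsto_of_tendsto_of_le_of_le' tendsto_const_nhds ht
      (Eventually.of_forall f.M_nonneg)
    filter_upwards [eventually_le_atBot 0] with σ hσ
    have hs : Summable (fun k => ‖f.a k‖) := by simpa using f.summable_real 0
    apply ciSup_le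
    intro t
    refine (f.norm_le _ σ (by simp)).trans ?_
    rw [← tsum_mul_left]
    apply (f.summable_real σ).tsum_le_tsum _ (hs.mul_left _)
    intro k
    have h3 : f.lam 0 ≤ f.lam k := f.lam_strictMono.monotone (Nat.zero_le k)
    have : σ * f.lam k ≤ σ * f.lam 0 := mul_le_mul_of_nonpos_left h3 hσ
    gcongr
  exact Real.tendsto_log_nhdsGT_zero.comp
    (tendsto_nhdsWithin_iff.2 ⟨hM, Eventually.of_forall f.M_pos⟩)

lemma VVDS.log_strictMono (f : VVDS E) : StrictMono (fun σ => Real.log (f.M σ)) := by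
  intro x y hxy
  by_contra hc
  have hc : Real.log (f.M y) ≤ Real.log (f.M x) := not_lt.1 hc
  obtain ⟨z, hz1, hz2⟩ := ((f.log_tendsto_bot.eventually (eventually_lt_atBot (Real.log (f.M x)))).and
    (eventually_lt_atBot x)).exists
  have h := f.log_convex.slope_mono_adjacent (Set.mem_univ z) (Set.mem_univ y) hz2 hxy
  have h1 : 0 < (Real.log (f.M x) - Real.log (f.M z)) / (x - z) := div_pos (by linarith) (by linarith)
  have h2 : (Real.log (f.M y) - Real.log (f.M x)) / (y - x) ≤ 0 :=
    div_nonpos_of_nonpos_of_nonneg (by linarith) (by linarith)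
  linarith

lemma VVDS.log_tendsto_top (f : VVDS E) : Tendsto (fun σ => Real.log (f.M σ)) atTop atTop := by
  set φ := fun σ => Real.log (f.M σ) with hφ
  have hc : 0 < φ 1 - φ 0 := sub_pos.2 (f.log_strictMono one_pos)
  have ht : Tendsto (fun σ : ℝ => (σ - 1) * (φ 1 - φ 0) + φ 1) atTop atTop := by
    apply tendsto_atTop_add_const_right
    apply Tendsto.atTop_mul_const hc
    exact tendsto_atTop_add_const_right _ (-1) tendsto_id
  apply tendsto_atTop_mono' _ _ ht
  filter_upwards [eventually_gt_atTop 1] with σ hσ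
  have h := f.log_convex.slope_mono_adjacent (Set.mem_univ 0) (Set.mem_univ σ) one_pos hσ
  change (φ 1 - φ 0) / (1 - 0) ≤ (φ σ - φ 1) / (σ - 1) at h
  rw [sub_zero, div_one, le_div_iff₀ (by linarith)] at h
  linarith

lemma VVDS.log_surj (f : VVDS E) : Function.Surjective (fun σ => Real.log (f.M σ)) :=
  (f.log_convex.locallyLipschitz.continuous).surjective f.log_tendsto_top f.log_tendsto_bot

lemma VVDS.M_strictMono (f : VVDS E) : StrictMono f.M := fun x y hxy =>
  (Real.log_lt_log_iff (f.M_pos x) (f.M_pos y)).1 (f.log_strictMono hxy)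

lemma VVDS.M_surj (f : VVDS E) {y : ℝ} (hy : 0 < y) : ∃ x, f.M x = y := by
  obtain ⟨x, hx⟩ := f.log_surj (Real.log y)
  exact ⟨x, Real.log_injOn_pos (f.M_pos x) hy hx⟩

lemma VVDS.Minv_M (f : VVDS E) (x : ℝ) : f.Minv (f.M x) = x := by
  have : {σ : ℝ | f.M x ≤ f.M σ} = Set.Ici x := by
    ext σ; simp [f.M_strictMono.le_iff_le]
  rw [VVDS.Minv, this, csInf_Ici]

lemma VVDS.M_Minv (f : VVDS E) {y : ℝ} (hy : 0 < y) : f.M (f.Minv y) = y := by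
  obtain ⟨x, rfl⟩ := f.M_surj hy
  rw [f.Minv_M]

lemma VVDS.map_comp (f : VVDS E) (g : VVDS F) :
    map (fun σ => g.Minv (f.M σ)) atTop = atTop := by
  have hm : StrictMono (fun σ => g.Minv (f.M σ)) := by
    intro x y hxy
    rw [← g.M_strictMono.lt_iff_lt]
    simp only [g.M_Minv (f.M_pos _)]
    exact f.M_strictMono hxy
  have hs : Function.Surjective (fun σ => g.Minv (f.M σ)) := by
    intro y
    obtain ⟨x, hx⟩ := f.M_surj (g.M_pos y)
    exact ⟨x, by simp only [hx, g.Minv_M]⟩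
  exact (StrictMono.orderIsoOfSurjective _ hm hs).map_atTop

lemma exists_up {U V κ d : ℝ} (hU : 0 < U) (hV : 0 < V) (hκ : 0 < κ) (hd : (U / V) ^ κ < d) :
    ∃ U' > U, ∃ V' < V, ∀ a b, 0 < a → a < U' → 0 < b → V' < b → (a / b) ^ κ ≤ d := by
  have hc : ContinuousAt (fun δ : ℝ => ((U + δ) / (V - δ)) ^ κ) 0 := by
    apply ContinuousAt.rpow_const _ (Or.inr hκ.le)
    apply ContinuousAt.div (by fun_prop) (by fun_prop)
    simpa using hV.ne'
  have h1 : ∀ᶠ δ in 𝓝[>] (0 : ℝ), ((U + δ) / (V - δ)) ^ κ < d :=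
    (hc.tendsto.eventually_lt_const (by simpa using hd)).filter_mono nhdsWithin_le_nhds
  have h2 : ∀ᶠ δ in 𝓝[>] (0 : ℝ), δ < V :=
    (eventually_lt_nhds hV).filter_mono nhdsWithin_le_nhds
  obtain ⟨δ, ⟨hδ1, hδ2⟩, hδ3⟩ := ((h1.and h2).and self_mem_nhdsWithin).exists
  have hδ3 : 0 < δ := hδ3
  refine ⟨U + δ, by linarith, V - δ, by linarith, fun a b ha ha' hb hb' => ?_⟩
  refine le_trans ?_ hδ1.le
  have : 0 < V - δ := by linarith
  apply Real.rpow_le_rpow (by positivity) _ hκ.le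
  gcongr

lemma exists_dn {U V κ d : ℝ} (hU : 0 < U) (hV : 0 < V) (hκ : 0 < κ) (hd : d < (U / V) ^ κ) :
    ∃ U' < U, ∃ V' > V, ∀ a b, 0 < a → U' < a → 0 < b → b < V' → d ≤ (a / b) ^ κ := by
  have hc : ContinuousAt (fun δ : ℝ => ((U - δ) / (V + δ)) ^ κ) 0 := by
    apply ContinuousAt.rpow_const _ (Or.inr hκ.le)
    apply ContinuousAt.div (by fun_prop) (by fun_prop)
    simpa using hV.ne'
  have h1 : ∀ᶠ δ in 𝓝[>] (0 : ℝ), d < ((U - δ) / (V + δ)) ^ κ :=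
    (hc.tendsto.eventually_const_lt (by simpa using hd)).filter_mono nhdsWithin_le_nhds
  have h2 : ∀ᶠ δ in 𝓝[>] (0 : ℝ), δ < U :=
    (eventually_lt_nhds hU).filter_mono nhdsWithin_le_nhds
  obtain ⟨δ, ⟨hδ1, hδ2⟩, hδ3⟩ := ((h1.and h2).and self_mem_nhdsWithin).exists
  have hδ3 : 0 < δ := hδ3
  refine ⟨U - δ, by linarith, V + δ, by linarith, fun a b ha ha' hb hb' => ?_⟩
  refine le_trans hδ1.le ?_
  have : 0 < U - δ := by linarith
  apply Real.rpow_le_rpow (by positivity) _ hκ.le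
  gcongr

lemma ratio_bounds {κ U₁ U₂ V₁ V₂ : ℝ} (hκ : 0 < κ) (hU₁ : 0 < U₁) (hU₂ : 0 < U₂)
    (hV₁ : 0 < V₁) (hV₂ : 0 < V₂) (u v w : ℝ → ℝ)
    (hu₁ : liminf (fun x => (u x : EReal)) atTop = U₁)
    (hu₂ : limsup (fun x => (u x : EReal)) atTop = U₂)
    (hv₁ : liminf (fun x => (v x : EReal)) atTop = V₁)
    (hv₂ : limsup (fun x => (v x : EReal)) atTop = V₂)
    (hup : ∀ᶠ x in atTop, 0 < u x) (hvp : ∀ᶠ x in atTop, 0 < v x)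
    (hw : ∀ᶠ x in atTop, w x = (u x / v x) ^ κ) :
    (((U₁ / V₂) ^ κ : ℝ) : EReal) ≤ liminf (fun x => (w x : EReal)) atTop ∧
    liminf (fun x => (w x : EReal)) atTop ≤ (((U₁ / V₁) ^ κ : ℝ) : EReal) ∧
    liminf (fun x => (w x : EReal)) atTop ≤ (((U₂ / V₂) ^ κ : ℝ) : EReal) ∧
    (((U₁ / V₁) ^ κ : ℝ) : EReal) ≤ limsup (fun x => (w x : EReal)) atTop ∧
    (((U₂ / V₂) ^ κ : ℝ) : EReal) ≤ limsup (fun x => (w x : EReal)) atTop ∧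
    limsup (fun x => (w x : EReal)) atTop ≤ (((U₂ / V₁) ^ κ : ℝ) : EReal) := by
  have eu1 : ∀ c : ℝ, c < U₁ → ∀ᶠ x in atTop, c < u x := fun c hc =>
    (eventually_lt_of_lt_liminf (hu₁.symm ▸ EReal.coe_lt_coe_iff.2 hc)).mono
      fun x hx => EReal.coe_lt_coe_iff.1 hx
  have ev1 : ∀ c : ℝ, c < V₁ → ∀ᶠ x in atTop, c < v x := fun c hc =>
    (eventually_lt_of_lt_liminf (hv₁.symm ▸ EReal.coe_lt_coe_iff.2 hc)).mono
      fun x hx => EReal.coe_lt_coe_iff.1 hx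
  have eu2 : ∀ c : ℝ, U₂ < c → ∀ᶠ x in atTop, u x < c := fun c hc =>
    (eventually_lt_of_limsup_lt (hu₂.symm ▸ EReal.coe_lt_coe_iff.2 hc)).mono
      fun x hx => EReal.coe_lt_coe_iff.1 hx
  have ev2 : ∀ c : ℝ, V₂ < c → ∀ᶠ x in atTop, v x < c := fun c hc =>
    (eventually_lt_of_limsup_lt (hv₂.symm ▸ EReal.coe_lt_coe_iff.2 hc)).mono
      fun x hx => EReal.coe_lt_coe_iff.1 hx
  have fu1 : ∀ c : ℝ, U₁ < c → ∃ᶠ x in atTop, u x < c := fun c hc =>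
    (frequently_lt_of_liminf_lt (by isBoundedDefault) (hu₁.symm ▸ EReal.coe_lt_coe_iff.2 hc)).mono
      fun x hx => EReal.coe_lt_coe_iff.1 hx
  have fv1 : ∀ c : ℝ, V₁ < c → ∃ᶠ x in atTop, v x < c := fun c hc =>
    (frequently_lt_of_liminf_lt (by isBoundedDefault) (hv₁.symm ▸ EReal.coe_lt_coe_iff.2 hc)).mono
      fun x hx => EReal.coe_lt_coe_iff.1 hx
  have fu2 : ∀ c : ℝ, c < U₂ → ∃ᶠ x in atTop, c < u x := fun c hc =>
    (frequently_lt_of_lt_limsup (by isBoundedDefault) (hu₂.symm ▸ EReal.coe_lt_coe_iff.2 hc)).mono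
      fun x hx => EReal.coe_lt_coe_iff.1 hx
  have fv2 : ∀ c : ℝ, c < V₂ → ∃ᶠ x in atTop, c < v x := fun c hc =>
    (frequently_lt_of_lt_limsup (by isBoundedDefault) (hv₂.symm ▸ EReal.coe_lt_coe_iff.2 hc)).mono
      fun x hx => EReal.coe_lt_coe_iff.1 hx
  have hall := hup.and (hvp.and hw)
  refine ⟨?_, ?_, ?_, ?_, ?_, ?_⟩
  · refine EReal.ge_of_forall_gt_iff_ge.1 fun d hd => ?_
    obtain ⟨a, ha, b, hb, hab⟩ := exists_dn hU₁ hV₂ hκ (EReal.coe_lt_coe_iff.1 hd)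
    apply le_liminf_of_le (by isBoundedDefault)
    filter_upwards [hall, eu1 a ha, ev2 b hb] with x h1 h2 h3
    rw [h1.2.2]
    exact EReal.coe_le_coe_iff.2 (hab _ _ h1.1 h2 h1.2.1 h3)
  · refine EReal.le_of_forall_lt_iff_le.1 fun d hd => ?_
    obtain ⟨a, ha, b, hb, hab⟩ := exists_up hU₁ hV₁ hκ (EReal.coe_lt_coe_iff.1 hd)
    apply liminf_le_of_frequently_le'
    refine ((fu1 a ha).and_eventually (hall.and (ev1 b hb))).mono ?_
    rintro x ⟨h2, h1, h3⟩
    rw [h1.2.2]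
    exact EReal.coe_le_coe_iff.2 (hab _ _ h1.1 h2 h1.2.1 h3)
  · refine EReal.le_of_forall_lt_iff_le.1 fun d hd => ?_
    obtain ⟨a, ha, b, hb, hab⟩ := exists_up hU₂ hV₂ hκ (EReal.coe_lt_coe_iff.1 hd)
    apply liminf_le_of_frequently_le'
    refine ((fv2 b hb).and_eventually (hall.and (eu2 a ha))).mono ?_
    rintro x ⟨h3, h1, h2⟩
    rw [h1.2.2]
    exact EReal.coe_le_coe_iff.2 (hab _ _ h1.1 h2 h1.2.1 h3)
  · refine EReal.ge_of_forall_gt_iff_ge.1 fun d hd => ?_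
    obtain ⟨a, ha, b, hb, hab⟩ := exists_dn hU₁ hV₁ hκ (EReal.coe_lt_coe_iff.1 hd)
    apply le_limsup_of_frequently_le'
    refine ((fv1 b hb).and_eventually (hall.and (eu1 a ha))).mono ?_
    rintro x ⟨h3, h1, h2⟩
    rw [h1.2.2]
    exact EReal.coe_le_coe_iff.2 (hab _ _ h1.1 h2 h1.2.1 h3)
  · refine EReal.ge_of_forall_gt_iff_ge.1 fun d hd => ?_
    obtain ⟨a, ha, b, hb, hab⟩ := exists_dn hU₂ hV₂ hκ (EReal.coe_lt_coe_iff.1 hd)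
    apply le_limsup_of_frequently_le'
    refine ((fu2 a ha).and_eventually (hall.and (ev2 b hb))).mono ?_
    rintro x ⟨h2, h1, h3⟩
    rw [h1.2.2]
    exact EReal.coe_le_coe_iff.2 (hab _ _ h1.1 h2 h1.2.1 h3)
  · refine EReal.le_of_forall_lt_iff_le.1 fun d hd => ?_
    obtain ⟨a, ha, b, hb, hab⟩ := exists_up hU₂ hV₁ hκ (EReal.coe_lt_coe_iff.1 hd)
    apply limsup_le_of_le (by isBoundedDefault)
    filter_upwards [hall, eu2 a ha, ev1 b hb] with x h1 h2 h3
    rw [h1.2.2]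
    exact EReal.coe_le_coe_iff.2 (hab _ _ h1.1 h2 h1.2.1 h3)

lemma tendsto_iter_log (k : ℕ) : Tendsto (fun x : ℝ => Real.log^[k] x) atTop atTop := by
  induction k with
  | zero => exact tendsto_id
  | succ k ih =>
    simp only [Function.iterate_succ_apply']
    exact Real.tendsto_log_atTop.comp ih

/-- Two exponents with positive lower type and finite upper type agree. -/
lemma exponent_le {b y : ℝ → ℝ} {α β : ℝ} (hy : Tendsto y atTop atTop)
    (h1 : (0 : EReal) < liminf (fun x => ((b x / y x ^ β : ℝ) : EReal)) atTop)
    (h2 : limsup (fun x => ((b x / y x ^ α : ℝ) : EReal)) atTop < ⊤) : β ≤ α := by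
  by_contra! hc
  obtain ⟨c, hc0, hc1⟩ := EReal.lt_iff_exists_real_btwn.1 h1
  obtain ⟨C, hC0, hC1⟩ := EReal.lt_iff_exists_real_btwn.1 h2
  have e1 := eventually_lt_of_lt_liminf hc1
  have e2 := eventually_lt_of_limsup_lt hC0
  have hcpos : 0 < c := EReal.coe_pos.1 hc0
  have ht : Tendsto (fun x => c * y x ^ (β - α)) atTop atTop :=
    ((tendsto_rpow_atTop (sub_pos.2 hc)).comp hy).const_mul_atTop hcpos
  obtain ⟨x, ⟨h3, h4⟩, h5, h6⟩ := ((e1.and e2).and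
    ((hy.eventually_gt_atTop 0).and (ht.eventually_gt_atTop C))).exists
  have h3 := EReal.coe_lt_coe_iff.1 h3
  have h4 := EReal.coe_lt_coe_iff.1 h4
  have p1 : 0 < y x ^ β := Real.rpow_pos_of_pos h5 _
  have p2 : 0 < y x ^ α := Real.rpow_pos_of_pos h5 _
  rw [lt_div_iff₀ p1] at h3
  rw [div_lt_iff₀ p2] at h4
  rw [Real.rpow_sub h5, mul_div_assoc', lt_div_iff₀ p2] at h6
  linarith

lemma eventually_pos_of_liminf {u : ℝ → ℝ}
    (h : (0 : EReal) < liminf (fun x => (u x : EReal)) atTop) : ∀ᶠ x in atTop, 0 < u x :=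
  (eventually_lt_of_lt_liminf h).mono fun _ hx => EReal.coe_pos.1 hx

lemma coe_toReal_of_pos {x : EReal} (h0 : 0 < x) (h1 : x < ⊤) : ((x.toReal : ℝ) : EReal) = x :=
  EReal.coe_toReal h1.ne (ne_bot_of_gt h0)

lemma order_comp (f : VVDS E) (g : VVDS F) (h : VVDS G) (p q m : ℕ) {r s : ℝ}
    (hs : 0 < s)
    (hf : Tendsto (fun σ : ℝ => Real.log^[m] (h.Minv (f.M σ)) / Real.log^[q] σ) atTop (𝓝 r))
    (hg : Tendsto (fun σ : ℝ => Real.log^[m] (h.Minv (g.M σ)) / Real.log^[p] σ) atTop (𝓝 s)) :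
    Tendsto (fun σ : ℝ => Real.log^[p] (g.Minv (f.M σ)) / Real.log^[q] σ) atTop (𝓝 (r / s)) := by
  have hC : Tendsto (fun σ => g.Minv (f.M σ)) atTop atTop := (f.map_comp g).le
  have hg' := hg.comp hC
  refine (hf.div hg' hs.ne').congr' ?_
  filter_upwards [hg'.eventually_const_lt hs] with σ h1
  simp only [Function.comp, Pi.div_apply, g.M_Minv (f.M_pos _)] at h1 ⊢
  set A := Real.log^[m] (h.Minv (f.M σ))
  have hA : A ≠ 0 := by rintro h0; rw [h0, zero_div] at h1; exact lt_irrefl _ h1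
  have hY : Real.log^[p] (g.Minv (f.M σ)) ≠ 0 := by
    rintro h0; rw [h0, div_zero] at h1; exact lt_irrefl _ h1
  rw [div_div_div_eq, mul_comm A, mul_div_mul_right _ _ hA]

lemma type_comp (f : VVDS E) (g : VVDS F) (h : VVDS G) (p q m : ℕ) {r s U₁ U₂ V₁ V₂ : ℝ}
    (hs : 0 < s) (hU₁ : 0 < U₁) (hU₂ : 0 < U₂) (hV₁ : 0 < V₁) (hV₂ : 0 < V₂)
    (hu₁ : liminf (fun σ : ℝ => ((Real.log^[m] (h.Minv (f.M σ)) / (Real.log^[q] σ) ^ r : ℝ) : EReal)) atTop = U₁)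
    (hu₂ : limsup (fun σ : ℝ => ((Real.log^[m] (h.Minv (f.M σ)) / (Real.log^[q] σ) ^ r : ℝ) : EReal)) atTop = U₂)
    (hv₁ : liminf (fun σ : ℝ => ((Real.log^[m] (h.Minv (g.M σ)) / (Real.log^[p] σ) ^ s : ℝ) : EReal)) atTop = V₁)
    (hv₂ : limsup (fun σ : ℝ => ((Real.log^[m] (h.Minv (g.M σ)) / (Real.log^[p] σ) ^ s : ℝ) : EReal)) atTop = V₂)
    (w : ℝ → ℝ) (hw : w = fun σ => Real.log^[p] (g.Minv (f.M σ)) / (Real.log^[q] σ) ^ (r / s)) :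
    (((U₁ / V₂) ^ (1 / s) : ℝ) : EReal) ≤ liminf (fun x => (w x : EReal)) atTop ∧
    liminf (fun x => (w x : EReal)) atTop ≤ (((U₁ / V₁) ^ (1 / s) : ℝ) : EReal) ∧
    liminf (fun x => (w x : EReal)) atTop ≤ (((U₂ / V₂) ^ (1 / s) : ℝ) : EReal) ∧
    (((U₁ / V₁) ^ (1 / s) : ℝ) : EReal) ≤ limsup (fun x => (w x : EReal)) atTop ∧
    (((U₂ / V₂) ^ (1 / s) : ℝ) : EReal) ≤ limsup (fun x => (w x : EReal)) atTop ∧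
    limsup (fun x => (w x : EReal)) atTop ≤ (((U₂ / V₁) ^ (1 / s) : ℝ) : EReal) := by
  have hC : Tendsto (fun σ => g.Minv (f.M σ)) atTop atTop := (f.map_comp g).le
  set v : ℝ → ℝ := fun x => Real.log^[m] (h.Minv (g.M x)) / (Real.log^[p] x) ^ s with hv
  have hup := eventually_pos_of_liminf (hu₁ ▸ EReal.coe_pos.2 hU₁)
  have hvp : ∀ᶠ x in atTop, 0 < v x := eventually_pos_of_liminf (hv₁ ▸ EReal.coe_pos.2 hV₁)
  have hvp' := hC.eventually hvp
  have e1 : liminf (fun σ => ((v (g.Minv (f.M σ)) : ℝ) : EReal)) atTop = V₁ := by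
    rw [← hv₁]
    conv_rhs => rw [← f.map_comp g]
    rfl
  have e2 : limsup (fun σ => ((v (g.Minv (f.M σ)) : ℝ) : EReal)) atTop = V₂ := by
    rw [← hv₂]
    conv_rhs => rw [← f.map_comp g]
    rfl
  refine ratio_bounds (one_div_pos.2 hs) hU₁ hU₂ hV₁ hV₂ _ _ w hu₁ hu₂ e1 e2 hup hvp' ?_
  filter_upwards [hup, hvp', (tendsto_iter_log q).eventually_gt_atTop 0,
    ((tendsto_iter_log p).comp hC).eventually_gt_atTop 0] with σ h1 h2 hX hY
  rw [hw]
  simp only [hv, Function.comp, g.M_Minv (f.M_pos _)] at h1 h2 hY ⊢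
  set A := Real.log^[m] (h.Minv (f.M σ))
  set Y := Real.log^[p] (g.Minv (f.M σ))
  set X := Real.log^[q] σ
  have hA : A ≠ 0 := by rintro h0; rw [h0, zero_div] at h1; exact lt_irrefl _ h1
  have p1 : 0 < X ^ r := Real.rpow_pos_of_pos hX _
  have p2 : 0 < Y ^ s := Real.rpow_pos_of_pos hY _
  have e3 : A / X ^ r / (A / Y ^ s) = Y ^ s / X ^ r := by field_simp
  rw [e3, Real.div_rpow p2.le p1.le, ← Real.rpow_mul hY.le, ← Real.rpow_mul hX.le,
    mul_one_div_cancel hs.ne', Real.rpow_one, mul_one_div]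

theorem stmt_19 (f : VVDS E) (g : VVDS F) (h : VVDS G) (p q m : ℕ)
    (hf1 : (0 : EReal) < relRittLowerOrder m q f h)
    (hfr : relRittLowerOrder m q f h = relRittOrder m q f h)
    (hf3 : relRittOrder m q f h < ⊤)
    (hg1 : (0 : EReal) < relRittLowerOrder m p g h)
    (hg2 : relRittLowerOrder m p g h ≤ relRittOrder m p g h)
    (hg3 : relRittOrder m p g h < ⊤)
    (hDf1 : (0 : EReal) < relRittType m q f h)
    (hDf2 : relRittType m q f h < ⊤)
    (hDbf1 : (0 : EReal) < relRittLowerType m q f h)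
    (hDbf2 : relRittLowerType m q f h < ⊤)
    (htf1 : (0 : EReal) < relRittWeakType m q f h)
    (htf2 : relRittWeakType m q f h < ⊤)
    (htbf1 : (0 : EReal) < relRittUpperWeakType m q f h)
    (htbf2 : relRittUpperWeakType m q f h < ⊤)
    (hDg1 : (0 : EReal) < relRittType m p g h)
    (hDg2 : relRittType m p g h < ⊤)
    (hDbg1 : (0 : EReal) < relRittLowerType m p g h)
    (hDbg2 : relRittLowerType m p g h < ⊤)
    (htg1 : (0 : EReal) < relRittWeakType m p g h)
    (htg2 : relRittWeakType m p g h < ⊤)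
    (htbg1 : (0 : EReal) < relRittUpperWeakType m p g h)
    (htbg2 : relRittUpperWeakType m p g h < ⊤)
    :
    ((((((relRittLowerType m q f h).toReal / (relRittType m p g h).toReal) ^ (1 / (relRittOrder m p g h).toReal)) : ℝ) : EReal) ≤ relRittWeakType p q f g ∧ relRittWeakType p q f g ≤ ((min (((relRittLowerType m q f h).toReal / (relRittLowerType m p g h).toReal) ^ (1 / (relRittOrder m p g h).toReal)) (((relRittType m q f h).toReal / (relRittType m p g h).toReal) ^ (1 / (relRittOrder m p g h).toReal)) : ℝ) : EReal) ∧ ((min (((relRittLowerType m q f h).toReal / (relRittLowerType m p g h).toReal) ^ (1 / (relRittOrder m p g h).toReal)) (((relRittType m q f h).toReal / (relRittType m p g h).toReal) ^ (1 / (relRittOrder m p g h).toReal)) : ℝ) : EReal) ≤ ((max (((relRittLowerType m q f h).toReal / (relRittLowerType m p g h).toReal) ^ (1 / (relRittOrder m p g h).toReal)) (((relRittType m q f h).toReal / (relRittType m p g h).toReal) ^ (1 / (relRittOrder m p g h).toReal)) : ℝ) : EReal) ∧ ((max (((relRittLowerType m q f h).toReal / (relRittLowerType m p g h).toReal) ^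 (1 / (relRittOrder m p g h).toReal)) (((relRittType m q f h).toReal / (relRittType m p g h).toReal) ^ (1 / (relRittOrder m p g h).toReal)) : ℝ) : EReal) ≤ relRittUpperWeakType p q f g ∧ relRittUpperWeakType p q f g ≤ (((((relRittType m q f h).toReal / (relRittLowerType m p g h).toReal) ^ (1 / (relRittOrder m p g h).toReal)) : ℝ) : EReal)) ∧ ((((((relRittWeakType m q f h).toReal / (relRittUpperWeakType m p g h).toReal) ^ (1 / (relRittLowerOrder m p g h).toReal)) : ℝ) : EReal) ≤ relRittLowerType p q f g ∧ relRittLowerType p q f g ≤ ((min (((relRittWeakType m q f h).toReal / (relRittWeakType m p g h).toReal) ^ (1 / (relRittLowerOrder m p g h).toReal)) (((relRittUpperWeakType m q f h).toReal / (relRittUpperWeakType m p g h).toReal) ^ (1 / (relRittLowerOrder m p g h).toReal)) : ℝ) : EReal) ∧ ((min (((relRittWeakType m q f h).toReal / (relRittWeakType m p g h).toReal) ^ (1 / (relRittLowerOrder m p g h).toReal)) (((relRittUpperWeakType m q f h).toReal / (relRittUpperWeakType m p g h).toReal) ^ (1 / (relRittLowerOrder m p g h).toReal)) : ℝ) : EReal)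 ≤ ((max (((relRittWeakType m q f h).toReal / (relRittWeakType m p g h).toReal) ^ (1 / (relRittLowerOrder m p g h).toReal)) (((relRittUpperWeakType m q f h).toReal / (relRittUpperWeakType m p g h).toReal) ^ (1 / (relRittLowerOrder m p g h).toReal)) : ℝ) : EReal) ∧ ((max (((relRittWeakType m q f h).toReal / (relRittWeakType m p g h).toReal) ^ (1 / (relRittLowerOrder m p g h).toReal)) (((relRittUpperWeakType m q f h).toReal / (relRittUpperWeakType m p g h).toReal) ^ (1 / (relRittLowerOrder m p g h).toReal)) : ℝ) : EReal) ≤ relRittType p q f g ∧ relRittType p q f g ≤ (((((relRittUpperWeakType m q f h).toReal / (relRittWeakType m p g h).toReal) ^ (1 / (relRittLowerOrder m p g h).toReal)) : ℝ) : EReal)) := by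
  have hgeq : relRittLowerOrder m p g h = relRittOrder m p g h := by
    refine le_antisymm hg2 ?_
    rw [← coe_toReal_of_pos hg1 (hg2.trans_lt hg3),
      ← coe_toReal_of_pos (hg1.trans_le hg2) hg3, EReal.coe_le_coe_iff]
    exact exponent_le (tendsto_iter_log (p - 1)) hDbg1 htbg2
  have w1 : relRittWeakType m q f h = relRittLowerType m q f h := by
    unfold relRittWeakType relRittLowerType; rw [hfr]
  have w2 : relRittUpperWeakType m q f h = relRittType m q f h := by
    unfold relRittUpperWeakType relRittType; rw [hfr]
  have w3 : relRittWeakType m p g h = relRittLowerType m p g h := by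
    unfold relRittWeakType relRittLowerType; rw [hgeq]
  have w4 : relRittUpperWeakType m p g h = relRittType m p g h := by
    unfold relRittUpperWeakType relRittType; rw [hgeq]
  have hfpos : 0 < relRittOrder m q f h := hfr ▸ hf1
  have hgpos : 0 < relRittOrder m p g h := hgeq ▸ hg1
  have cf := coe_toReal_of_pos hfpos hf3
  have cg := coe_toReal_of_pos hgpos hg3
  have sg : 0 < (relRittOrder m p g h).toReal := EReal.toReal_pos hgpos hg3.ne
  have tf := EReal.tendsto_coe.1 (tendsto_of_liminf_eq_limsup
    (hfr.trans cf.symm) cf.symm)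
  have tg := EReal.tendsto_coe.1 (tendsto_of_liminf_eq_limsup
    (hgeq.trans cg.symm) cg.symm)
  have tfg := EReal.tendsto_coe.2 (order_comp f g h p q m sg tf tg)
  have o1 : relRittOrder p q f g = _ := tfg.limsup_eq
  have o2 : relRittLowerOrder p q f g = _ := tfg.liminf_eq
  have w5 : relRittWeakType p q f g = relRittLowerType p q f g := by
    unfold relRittWeakType relRittLowerType; rw [o1, o2]
  have w6 : relRittUpperWeakType p q f g = relRittType p q f g := by
    unfold relRittUpperWeakType relRittType; rw [o1, o2]
  have key := type_comp f g h (p - 1) (q - 1) (m - 1)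
    (r := (relRittOrder m q f h).toReal) sg
    (EReal.toReal_pos hDbf1 hDbf2.ne) (EReal.toReal_pos hDf1 hDf2.ne)
    (EReal.toReal_pos hDbg1 hDbg2.ne) (EReal.toReal_pos hDg1 hDg2.ne)
    (coe_toReal_of_pos hDbf1 hDbf2).symm (coe_toReal_of_pos hDf1 hDf2).symm
    (coe_toReal_of_pos hDbg1 hDbg2).symm (coe_toReal_of_pos hDg1 hDg2).symm _ rfl
  have l1 : relRittLowerType p q f g = liminf (fun σ : ℝ => ((Real.log^[p-1] (g.Minv (f.M σ)) /
      (Real.log^[q-1] σ) ^ ((relRittOrder m q f h).toReal / (relRittOrder m p g h).toReal) : ℝ)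
        : EReal)) atTop := by
    unfold relRittLowerType; rw [o1, EReal.toReal_coe]
  have l2 : relRittType p q f g = limsup (fun σ : ℝ => ((Real.log^[p-1] (g.Minv (f.M σ)) /
      (Real.log^[q-1] σ) ^ ((relRittOrder m q f h).toReal / (relRittOrder m p g h).toReal) : ℝ)
        : EReal)) atTop := by
    unfold relRittType; rw [o1, EReal.toReal_coe]
  rw [← l1, ← l2] at key
  rw [w1, w2, w3, w4, w5, w6, hgeq, and_self]
  obtain ⟨k1, k2, k3, k4, k5, k6⟩ := key
  refine ⟨k1, ?_, ?_, ?_, k6⟩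
  · rcases min_choice (((relRittLowerType m q f h).toReal / (relRittLowerType m p g h).toReal) ^ (1 / (relRittOrder m p g h).toReal)) (((relRittType m q f h).toReal / (relRittType m p g h).toReal) ^ (1 / (relRittOrder m p g h).toReal)) with e | e
    · rw [e]; exact k2
    · rw [e]; exact k3
  · exact EReal.coe_le_coe_iff.2 min_le_max
  · rcases max_choice (((relRittLowerType m q f h).toReal / (relRittLowerType m p g h).toReal) ^ (1 / (relRittOrder m p g h).toReal)) (((relRittType m q f h).toReal / (relRittType m p g h).toReal) ^ (1 / (relRittOrder m p g h).toReal)) with e | e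
    · rw [e]; exact k4
    · rw [e]; exact k5
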